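/- arXiv:2402.06576 — 3 statements merged into one kernel-verified Lean document; each statement's English description precedes it below -/
import Mathlib

section
/- If the X3C instance (U, C) has an exact cover, then the derived trading instance admits a feasible assignment whose welfare is exactly ℓ(Q − 3). -/
open Finset

section X3C

/-- An exact cover for the X3C instance given by the ordered triples `C j`
(listing the elements of each 3-set in increasing order): a subcollection of
pairwise disjoint triples covering all of `U = Fin (3 * l)`. -/
def ExactCover (l r : ℕ) (C : Fin r → Fin 3 → Fin (3 * l)) : Prop :=
  ∃ I : Finset (Fin r),
    (∀ j ∈ I, ∀ j' ∈ I, j ≠ j' → ∀ p p' : Fin 3, C j p ≠ C j' p') ∧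
    (∀ u : Fin (3 * l), ∃ j ∈ I, ∃ p : Fin 3, C j p = u)

/-- The value of the buyer units: the first two units of each buyer have value 0,
the third has value `Q`. -/
def bval (Q : ℤ) (p : Fin 3) : ℤ := if p = 2 then Q else 0

/-- The index `p - 1` (the preceding unit of the same buyer). -/
def predIdx {n : ℕ} (p : Fin n) : Fin n :=
  ⟨(p : ℕ) - 1, lt_of_le_of_lt (Nat.sub_le _ _) p.isLt⟩

/-- A feasible assignment for the derived trading instance: a set of pairs
(seller unit, buyer unit `(j, p)`), each pair compatible (the seller unit is the
`p`-th element of `C j`), each unit occurring in at most one pair, and each buyer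
unit matched only if the preceding unit of the same buyer is matched. -/
def Feasible (l r : ℕ) (C : Fin r → Fin 3 → Fin (3 * l))
    (T : Finset (Fin (3 * l) × (Fin r × Fin 3))) : Prop :=
  (∀ q ∈ T, q.1 = C q.2.1 q.2.2) ∧
  (∀ q ∈ T, ∀ q' ∈ T, q.1 = q'.1 → q = q') ∧
  (∀ q ∈ T, ∀ q' ∈ T, q.2 = q'.2 → q = q') ∧
  (∀ j : Fin r, ∀ p : Fin 3, (p : ℕ) ≠ 0 →
    (∃ q ∈ T, q.2 = (j, p)) → (∃ q ∈ T, q.2 = (j, predIdx p)))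

/-- The welfare of an assignment: each seller unit has value 1, so each traded pair
contributes (buyer-unit value − 1). -/
def tradeWelfare (l r : ℕ) (Q : ℤ)
    (T : Finset (Fin (3 * l) × (Fin r × Fin 3))) : ℤ :=
  ∑ q ∈ T, (bval Q q.2.2 - 1)

/-- The buyers all three of whose units are matched in `T`. -/
def FullBuyers (l r : ℕ) (T : Finset (Fin (3 * l) × (Fin r × Fin 3))) :
    Finset (Fin r) :=
  Finset.univ.filter fun j => ∀ p : Fin 3, ∃ q ∈ T, q.2 = (j, p)

/-- The trades of the buyers in `I`, each buying all three of its units. -/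
def fullTrades {l r : ℕ} (C : Fin r → Fin 3 → Fin (3 * l)) (I : Finset (Fin r)) :
    Finset (Fin (3 * l) × (Fin r × Fin 3)) :=
  (I ×ˢ univ).map ⟨fun x => (C x.1 x.2, x), fun _ _ h => (Prod.ext_iff.1 h).2⟩

theorem mem_fullTrades {l r : ℕ} {C : Fin r → Fin 3 → Fin (3 * l)} {I : Finset (Fin r)}
    {q : Fin (3 * l) × (Fin r × Fin 3)} :
    q ∈ fullTrades C I ↔ q.2.1 ∈ I ∧ q.1 = C q.2.1 q.2.2 := by
  obtain ⟨u, j, p⟩ := q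
  simp only [fullTrades, mem_map, mem_product, mem_univ, and_true]
  constructor
  · rintro ⟨x, hx, ⟨⟩⟩
    exact ⟨hx, rfl⟩
  · rintro ⟨hj, rfl⟩
    exact ⟨(j, p), hj, rfl⟩

theorem injOn_of_disjoint {l r : ℕ} {C : Fin r → Fin 3 → Fin (3 * l)} {I : Finset (Fin r)}
    (hC : ∀ j, Function.Injective (C j))
    (hI : ∀ j ∈ I, ∀ j' ∈ I, j ≠ j' → ∀ p p' : Fin 3, C j p ≠ C j' p') :
    Set.InjOn (fun x : Fin r × Fin 3 => C x.1 x.2) (I ×ˢ univ : Finset (Fin r × Fin 3)) := by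
  rintro ⟨j, p⟩ hj ⟨j', p'⟩ hj' h
  simp only [coe_product, coe_univ, Set.mem_prod, mem_coe, Set.mem_univ, and_true] at hj hj'
  obtain rfl : j = j' := by
    by_contra hne
    exact hI j hj j' hj' hne p p' h
  exact Prod.ext rfl (hC j h)

theorem card_eq_of_exactCover {l r : ℕ} {C : Fin r → Fin 3 → Fin (3 * l)} {I : Finset (Fin r)}
    (hC : ∀ j, Function.Injective (C j))
    (hI : ∀ j ∈ I, ∀ j' ∈ I, j ≠ j' → ∀ p p' : Fin 3, C j p ≠ C j' p')
    (hU : ∀ u : Fin (3 * l), ∃ j ∈ I, ∃ p : Fin 3, C j p = u) : #I = l := by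
  have himage : (I ×ˢ univ).image (fun x : Fin r × Fin 3 => C x.1 x.2) = univ := by
    refine eq_univ_of_forall fun u => ?_
    obtain ⟨j, hj, p, rfl⟩ := hU u
    exact mem_image.2 ⟨(j, p), by simpa using hj, rfl⟩
  have hcard := card_image_of_injOn (injOn_of_disjoint hC hI)
  rw [himage, card_product, card_univ, card_univ, Fintype.card_fin, Fintype.card_fin] at hcard
  omega

theorem feasible_fullTrades {l r : ℕ} {C : Fin r → Fin 3 → Fin (3 * l)} {I : Finset (Fin r)}
    (hC : ∀ j, Function.Injective (C j))
    (hI : ∀ j ∈ I, ∀ j' ∈ I, j ≠ j' → ∀ p p' : Fin 3, C j p ≠ C j' p') :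
    Feasible l r C (fullTrades C I) := by
  simp only [Feasible, mem_fullTrades]
  refine ⟨fun q hq => hq.2, fun q hq q' hq' h => ?_, fun q hq q' hq' h => ?_, ?_⟩
  · refine Prod.ext h (injOn_of_disjoint hC hI ?_ ?_ (hq.2.symm.trans (h.trans hq'.2)))
    · simpa using hq.1
    · simpa using hq'.1
  · exact Prod.ext (by rw [hq.2, hq'.2, h]) h
  · rintro j p - ⟨⟨u, x⟩, hq, rfl⟩
    exact ⟨(C j (predIdx p), (j, predIdx p)), ⟨hq.1, rfl⟩, rfl⟩

theorem tradeWelfare_fullTrades {l r : ℕ} (C : Fin r → Fin 3 → Fin (3 * l))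
    (I : Finset (Fin r)) (Q : ℤ) :
    tradeWelfare l r Q (fullTrades C I) = #I * (Q - 3) := by
  have hbuyer : ∑ p : Fin 3, (bval Q p - 1) = Q - 3 := by
    simp [bval]
  rw [tradeWelfare, fullTrades, sum_map, sum_product]
  change ∑ _ ∈ I, ∑ p : Fin 3, (bval Q p - 1) = _
  rw [hbuyer, sum_const, nsmul_eq_mul]

/-- if the X3C instance has an exact cover, then the derived trading
instance admits a feasible assignment of welfare exactly `l * (Q - 3)`. -/
theorem exactCover_implies_assignment
    (l r : ℕ) (C : Fin r → Fin 3 → Fin (3 * l))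
    (hC : ∀ j : Fin r, StrictMono (C j))
    (Q : ℤ) (hQ : 4 ≤ Q)
    (hcov : ExactCover l r C) :
    ∃ T : Finset (Fin (3 * l) × (Fin r × Fin 3)),
      Feasible l r C T ∧ tradeWelfare l r Q T = (l : ℤ) * (Q - 3) := by
  obtain ⟨I, hI, hU⟩ := hcov
  have hinj := fun j => (hC j).injective
  refine ⟨fullTrades C I, feasible_fullTrades hinj hI, ?_⟩
  rw [tradeWelfare_fullTrades, card_eq_of_exactCover hinj hI hU]

end X3C
end

section
/- In the derived trading instance, every feasible assignment with welfare at least ℓ(Q − 3) assigns three seller units to exactly ℓ of the buyers and assigns all t = 3ℓ seller water units. -/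
open Finset

section X3C

theorem Feasible.card_le {l r : ℕ} {C : Fin r → Fin 3 → Fin (3 * l)}
    {T : Finset (Fin (3 * l) × (Fin r × Fin 3))} (hT : Feasible l r C T) :
    T.card ≤ 3 * l := by
  have h := Finset.card_le_card_of_injOn (s := T) (t := Finset.univ) Prod.fst
    (fun _ _ => Finset.mem_univ _) (fun q hq q' hq' => hT.2.1 q hq q' hq')
  simpa using h

theorem three_mul_card_fullBuyers_le {l r : ℕ}
    (T : Finset (Fin (3 * l) × (Fin r × Fin 3))) :
    3 * (FullBuyers l r T).card ≤ T.card := by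
  have hsub : FullBuyers l r T ×ˢ (Finset.univ : Finset (Fin 3)) ⊆ T.image Prod.snd := by
    rintro ⟨j, p⟩ hjp
    simp only [FullBuyers, Finset.mem_product, Finset.mem_filter] at hjp
    exact Finset.mem_image.2 (hjp.1.2 p)
  have h := (Finset.card_le_card hsub).trans Finset.card_image_le
  rw [Finset.card_product, Finset.card_univ, Fintype.card_fin] at h
  omega

theorem Feasible.card_filter_two_le {l r : ℕ} {C : Fin r → Fin 3 → Fin (3 * l)}
    {T : Finset (Fin (3 * l) × (Fin r × Fin 3))} (hT : Feasible l r C T) :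
    (T.filter fun q => q.2.2 = 2).card ≤ (FullBuyers l r T).card := by
  obtain ⟨-, -, hinj, hpred⟩ := hT
  refine Finset.card_le_card_of_injOn (fun q => q.2.1) ?_ ?_
  · rintro ⟨i, j, p⟩ hq
    obtain ⟨hq, rfl⟩ : (i, j, p) ∈ T ∧ p = 2 := by simpa using hq
    have h2 : ∃ q ∈ T, q.2 = (j, (2 : Fin 3)) := ⟨_, hq, rfl⟩
    have h1 : ∃ q ∈ T, q.2 = (j, (1 : Fin 3)) := hpred j 2 (by decide) h2
    have h0 : ∃ q ∈ T, q.2 = (j, (0 : Fin 3)) := hpred j 1 (by decide) h1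
    refine Finset.mem_coe.2 (Finset.mem_filter.2 ⟨Finset.mem_univ _, fun p => ?_⟩)
    fin_cases p
    · exact h0
    · exact h1
    · exact h2
  · intro q hq q' hq' h
    have hq := Finset.mem_filter.1 (Finset.mem_coe.1 hq)
    have hq' := Finset.mem_filter.1 (Finset.mem_coe.1 hq')
    exact hinj q hq.1 q' hq'.1 (Prod.ext h (hq.2.trans hq'.2.symm))

theorem tradeWelfare_eq (l r : ℕ) (Q : ℤ)
    (T : Finset (Fin (3 * l) × (Fin r × Fin 3))) :
    tradeWelfare l r Q T = (T.filter fun q => q.2.2 = 2).card * Q - T.card := by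
  simp [tradeWelfare, bval, Finset.sum_sub_distrib, ← Finset.sum_filter]

/-- every feasible assignment of welfare at least `l * (Q - 3)` assigns
three seller units to exactly `l` of the buyers and assigns all `3 * l` seller units. -/
theorem highWelfare_structure
    (l r : ℕ) (C : Fin r → Fin 3 → Fin (3 * l))
    (hC : ∀ j : Fin r, StrictMono (C j))
    (Q : ℤ) (hQ : 4 ≤ Q)
    (T : Finset (Fin (3 * l) × (Fin r × Fin 3)))
    (hT : Feasible l r C T)
    (hwelf : (l : ℤ) * (Q - 3) ≤ tradeWelfare l r Q T) :
    (FullBuyers l r T).card = l ∧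
    (∀ i : Fin (3 * l), ∃ q ∈ T, q.1 = i) := by
  rw [tradeWelfare_eq] at hwelf
  have hle := hT.card_le
  have hfull := three_mul_card_fullBuyers_le T
  have htwo := hT.card_filter_two_le
  have hcard : (FullBuyers l r T).card = l := by
    refine le_antisymm (by omega) ?_
    have hQle : ((T.filter fun q => q.2.2 = 2).card : ℤ) * Q ≤ (FullBuyers l r T).card * Q :=
      mul_le_mul_of_nonneg_right (by exact_mod_cast htwo) (by linarith)
    have hfull' : 3 * ((FullBuyers l r T).card : ℤ) ≤ T.card := by exact_mod_cast hfull
    have hmul : (l : ℤ) * (Q - 3) ≤ (FullBuyers l r T).card * (Q - 3) := by linarith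
    exact_mod_cast le_of_mul_le_mul_right hmul (by linarith)
  refine ⟨hcard, fun i => ?_⟩
  have himage : T.image Prod.fst = Finset.univ := by
    rw [← Finset.card_eq_iff_eq_univ, Fintype.card_fin,
      Finset.card_image_of_injOn fun q hq q' hq' => hT.2.1 q hq q' hq']
    omega
  exact Finset.mem_image.1 (himage ▸ Finset.mem_univ i)

end X3C
end

section
/- The X3C instance (U, C) has an exact cover if and only if the derived trading instance admits a feasible assignment with welfare at least ℓ(Q − 3); moreover, from any feasible assignment with welfare at least ℓ(Q − 3), the ℓ sets of C corresponding to the buyers that receive three units form an exact cover of U. -/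
open Finset

section X3C

/-- The compatible pair consisting of a buyer unit and its seller unit. -/
def compatiblePair {l r : ℕ} (C : Fin r → Fin 3 → Fin (3 * l)) :
    Fin r × Fin 3 ↪ Fin (3 * l) × (Fin r × Fin 3) :=
  ⟨fun x => (C x.1 x.2, x), fun _ _ h => congrArg Prod.snd h⟩

theorem mem_fullBuyers_iff {l r : ℕ} {T : Finset (Fin (3 * l) × (Fin r × Fin 3))} {j : Fin r} :
    j ∈ FullBuyers l r T ↔ ∀ p : Fin 3, ∃ q ∈ T, q.2 = (j, p) := by
  simp [FullBuyers]

namespace Feasible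

variable {l r : ℕ} {C : Fin r → Fin 3 → Fin (3 * l)}
  {T : Finset (Fin (3 * l) × (Fin r × Fin 3))}

theorem compatiblePair_mem (hT : Feasible l r C T) {j : Fin r} (hj : j ∈ FullBuyers l r T)
    (p : Fin 3) : compatiblePair C (j, p) ∈ T := by
  obtain ⟨⟨u, x⟩, hq, rfl⟩ := mem_fullBuyers_iff.1 hj p
  obtain rfl : u = C j p := hT.1 _ hq
  exact hq

theorem mem_fullBuyers_of_third_mem (hT : Feasible l r C T) {j : Fin r}
    (h₂ : ∃ q ∈ T, q.2 = (j, 2)) : j ∈ FullBuyers l r T := by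
  have h₁ : ∃ q ∈ T, q.2 = (j, 1) := hT.2.2.2 j 2 (by decide) h₂
  have h₀ : ∃ q ∈ T, q.2 = (j, 0) := hT.2.2.2 j 1 (by decide) h₁
  rw [mem_fullBuyers_iff]
  intro p
  fin_cases p
  exacts [h₀, h₁, h₂]

theorem map_fullBuyers_subset (hT : Feasible l r C T) :
    (FullBuyers l r T ×ˢ univ).map (compatiblePair C) ⊆ T := by
  intro q hq
  obtain ⟨⟨j, p⟩, hx, rfl⟩ := mem_map.1 hq
  exact hT.compatiblePair_mem (mem_product.1 hx).1 p

theorem card_le_s6 (hT : Feasible l r C T) : T.card ≤ 3 * l := by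
  simpa using card_le_card_of_injOn (t := univ) Prod.fst (fun _ _ => mem_univ _)
    fun q hq q' hq' h => hT.2.1 q hq q' hq' h

theorem three_mul_card_fullBuyers_le (hT : Feasible l r C T) :
    3 * (FullBuyers l r T).card ≤ T.card := by
  simpa [mul_comm] using card_le_card hT.map_fullBuyers_subset

theorem card_third_units_eq (hT : Feasible l r C T) :
    (T.filter fun q => q.2.2 = 2).card = (FullBuyers l r T).card := by
  refine card_bij (fun q _ => q.2.1) ?_ ?_ ?_
  · rintro ⟨u, j, p⟩ hq
    obtain ⟨hq, rfl⟩ := mem_filter.1 hq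
    exact hT.mem_fullBuyers_of_third_mem ⟨_, hq, rfl⟩
  · intro q hq q' hq' h
    rw [mem_filter] at hq hq'
    exact hT.2.2.1 q hq.1 q' hq'.1 (Prod.ext h (hq.2.trans hq'.2.symm))
  · intro j hj
    exact ⟨_, mem_filter.2 ⟨hT.compatiblePair_mem hj 2, rfl⟩, rfl⟩

theorem tradeWelfare_eq (hT : Feasible l r C T) (Q : ℤ) :
    tradeWelfare l r Q T = (FullBuyers l r T).card * Q - T.card := by
  simp [tradeWelfare, bval, sum_sub_distrib, ← sum_filter, hT.card_third_units_eq]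

theorem card_fullBuyers_eq (hT : Feasible l r C T) {Q : ℤ} (hQ : 3 < Q)
    (hW : (l : ℤ) * (Q - 3) ≤ tradeWelfare l r Q T) : (FullBuyers l r T).card = l := by
  have h₁ := hT.card_le_s6
  have h₂ := hT.three_mul_card_fullBuyers_le
  rw [hT.tradeWelfare_eq] at hW
  refine le_antisymm (by omega) ?_
  zify at h₂ ⊢
  exact le_of_mul_le_mul_right (by linarith) (sub_pos.2 hQ)

theorem fullBuyers_disjoint (hT : Feasible l r C T) {j j' : Fin r}
    (hj : j ∈ FullBuyers l r T) (hj' : j' ∈ FullBuyers l r T) (hne : j ≠ j') (p p' : Fin 3) :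
    C j p ≠ C j' p' := fun h =>
  hne <| congrArg (fun q => q.2.1) <|
    hT.2.1 _ (hT.compatiblePair_mem hj p) _ (hT.compatiblePair_mem hj' p') h

theorem fullBuyers_cover (hT : Feasible l r C T) (hcard : (FullBuyers l r T).card = l)
    (u : Fin (3 * l)) : ∃ j ∈ FullBuyers l r T, ∃ p : Fin 3, C j p = u := by
  have hinj : Set.InjOn (fun x : Fin r × Fin 3 => C x.1 x.2)
      (FullBuyers l r T ×ˢ (univ : Finset (Fin 3)) : Finset _) := by
    intro x hx y hy h
    exact congrArg Prod.snd <|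
      hT.2.1 _ (hT.compatiblePair_mem (mem_product.1 hx).1 x.2) _
        (hT.compatiblePair_mem (mem_product.1 hy).1 y.2) h
  have himage : (FullBuyers l r T ×ˢ univ).image (fun x => C x.1 x.2) = univ := by
    rw [← card_eq_iff_eq_univ, card_image_of_injOn hinj]
    simp [hcard, mul_comm]
  obtain ⟨⟨j, p⟩, hx, h⟩ := mem_image.1 (himage.symm ▸ mem_univ u)
  exact ⟨j, (mem_product.1 hx).1, p, h⟩

end Feasible

theorem feasible_map_compatiblePair {l r : ℕ} {C : Fin r → Fin 3 → Fin (3 * l)}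
    (hC : ∀ j, Function.Injective (C j)) {I : Finset (Fin r)}
    (hI : ∀ j ∈ I, ∀ j' ∈ I, j ≠ j' → ∀ p p' : Fin 3, C j p ≠ C j' p') :
    Feasible l r C ((I ×ˢ univ).map (compatiblePair C)) := by
  refine ⟨?_, ?_, ?_, ?_⟩
  · intro q hq
    obtain ⟨x, -, rfl⟩ := mem_map.1 hq
    rfl
  · intro q hq q' hq' h
    obtain ⟨⟨j, p⟩, hx, rfl⟩ := mem_map.1 hq
    obtain ⟨⟨j', p'⟩, hx', rfl⟩ := mem_map.1 hq'
    obtain rfl : j = j' := by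
      by_contra hne
      exact hI j (mem_product.1 hx).1 j' (mem_product.1 hx').1 hne p p' h
    obtain rfl : p = p' := hC j h
    rfl
  · intro q hq q' hq' h
    obtain ⟨x, -, rfl⟩ := mem_map.1 hq
    obtain ⟨x', -, rfl⟩ := mem_map.1 hq'
    exact congrArg _ h
  · rintro j p - ⟨q, hq, h⟩
    obtain ⟨x, hx, rfl⟩ := mem_map.1 hq
    obtain rfl : x = (j, p) := h
    exact ⟨compatiblePair C (j, predIdx p),
      mem_map_of_mem _ (mem_product.2 ⟨(mem_product.1 hx).1, mem_univ _⟩), rfl⟩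

theorem tradeWelfare_map_compatiblePair {l r : ℕ} (C : Fin r → Fin 3 → Fin (3 * l))
    (I : Finset (Fin r)) (Q : ℤ) :
    tradeWelfare l r Q ((I ×ˢ univ).map (compatiblePair C)) = I.card * (Q - 3) := by
  have hsum : ∑ p : Fin 3, (bval Q p - 1) = Q - 3 := by
    simp [bval]
  rw [tradeWelfare, sum_map, sum_product]
  change ∑ _j ∈ I, ∑ p : Fin 3, (bval Q p - 1) = _
  rw [hsum, sum_const, nsmul_eq_mul]

theorem le_card_of_cover {l r : ℕ} {C : Fin r → Fin 3 → Fin (3 * l)} {I : Finset (Fin r)}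
    (hI : ∀ u : Fin (3 * l), ∃ j ∈ I, ∃ p : Fin 3, C j p = u) : l ≤ I.card := by
  have h : (univ : Finset (Fin (3 * l))).card ≤ (I ×ˢ (univ : Finset (Fin 3))).card := by
    refine card_le_card_of_surjOn (fun x => C x.1 x.2) fun u _ => ?_
    obtain ⟨j, hj, p, hp⟩ := hI u
    exact ⟨(j, p), mem_product.2 ⟨hj, mem_univ p⟩, hp⟩
  simp only [card_product, card_univ, Fintype.card_fin] at h
  omega

/-- the X3C instance has an exact cover iff the derived trading instance
admits a feasible assignment with welfare at least `l * (Q - 3)`; moreover, from any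
such assignment, the `l` sets corresponding to buyers receiving three units form an
exact cover of `U`. -/
theorem exactCover_iff_highWelfare
    (l r : ℕ) (C : Fin r → Fin 3 → Fin (3 * l))
    (hC : ∀ j : Fin r, StrictMono (C j))
    (Q : ℤ) (hQ : 4 ≤ Q) :
    (ExactCover l r C ↔
      ∃ T : Finset (Fin (3 * l) × (Fin r × Fin 3)),
        Feasible l r C T ∧ (l : ℤ) * (Q - 3) ≤ tradeWelfare l r Q T) ∧
    (∀ T : Finset (Fin (3 * l) × (Fin r × Fin 3)),
      Feasible l r C T → (l : ℤ) * (Q - 3) ≤ tradeWelfare l r Q T →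
      (FullBuyers l r T).card = l ∧
      (∀ j ∈ FullBuyers l r T, ∀ j' ∈ FullBuyers l r T, j ≠ j' →
        ∀ p p' : Fin 3, C j p ≠ C j' p') ∧
      (∀ u : Fin (3 * l), ∃ j ∈ FullBuyers l r T, ∃ p : Fin 3, C j p = u)) := by
  have key : ∀ T : Finset (Fin (3 * l) × (Fin r × Fin 3)),
      Feasible l r C T → (l : ℤ) * (Q - 3) ≤ tradeWelfare l r Q T →
      (FullBuyers l r T).card = l ∧
      (∀ j ∈ FullBuyers l r T, ∀ j' ∈ FullBuyers l r T, j ≠ j' →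
        ∀ p p' : Fin 3, C j p ≠ C j' p') ∧
      (∀ u : Fin (3 * l), ∃ j ∈ FullBuyers l r T, ∃ p : Fin 3, C j p = u) := by
    intro T hT hW
    have hcard := hT.card_fullBuyers_eq (by linarith) hW
    exact ⟨hcard, fun _ hj _ hj' => hT.fullBuyers_disjoint hj hj', hT.fullBuyers_cover hcard⟩
  refine ⟨⟨?_, ?_⟩, key⟩
  · rintro ⟨I, hdisj, hcover⟩
    refine ⟨_, feasible_map_compatiblePair (fun j => (hC j).injective) hdisj, ?_⟩
    rw [tradeWelfare_map_compatiblePair]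
    exact mul_le_mul_of_nonneg_right (by exact_mod_cast le_card_of_cover hcover) (by linarith)
  · rintro ⟨T, hT, hW⟩
    exact ⟨_, (key T hT hW).2⟩

end X3C
end
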